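/- Fix n ≥ 2 and real numbers y₁,…,yₙ satisfying ∑_{i=1}^n yᵢ = 0 and ∑_{i=1}^n yᵢ² = n, and let b₁ = (1/n)∑_{i=1}^n yᵢ³. For β > 1 let T_{n,β} = n ∫_{-∞}^{∞} ( (1/n)∑_{j=1}^n exp(t·yⱼ) − exp(t²/2) )² exp(−βt²) dt and let τ(β) = 1/√(β−1) − 2/√(β−1/2) − 2/((4β−2)√(β−1/2)) + 1/√β + 1/(2β^{3/2}) + 3/(16β^{5/2}). Then lim_{β→∞} (96/5)·β^{7/2}·( T_{n,β}/(n√π) − τ(β) ) = b₁². -/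

import Mathlib

open MeasureTheory Filter Real

lemma exp_linear_sub_quadratic_eq (a : ℝ) {b : ℝ} (hb : 0 < b) (t : ℝ) :
    exp (a * t - b * t ^ 2) = exp (a ^ 2 / (4 * b)) * exp (-b * (t - a / (2 * b)) ^ 2) := by
  rw [← Real.exp_add]
  congr 1
  field_simp
  ring

lemma integrable_exp_linear_sub_quadratic (a : ℝ) {b : ℝ} (hb : 0 < b) :
    Integrable fun t : ℝ => exp (a * t - b * t ^ 2) := by
  simp_rw [exp_linear_sub_quadratic_eq a hb]
  exact ((integrable_exp_neg_mul_sq hb).comp_sub_right (a / (2 * b))).const_mul _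

lemma integral_exp_linear_sub_quadratic (a : ℝ) {b : ℝ} (hb : 0 < b) :
    ∫ t : ℝ, exp (a * t - b * t ^ 2) = √π * (exp (a ^ 2 / 4 / b) / √b) := by
  simp_rw [exp_linear_sub_quadratic_eq a hb]
  rw [integral_const_mul, integral_sub_right_eq_self (fun t : ℝ => exp (-b * t ^ 2)),
    integral_gaussian, sqrt_div pi_pos.le, div_div]
  ring

/-- The closed form of the weighted `L²` distance between an empirical moment generating
function and the standard normal one. -/
lemma integral_sq_empirical_mgf_sub_gaussian {n : ℕ} (y : Fin n → ℝ) {β : ℝ} (hβ : 1 < β) :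
    ∫ t : ℝ, ((1 / n : ℝ) * ∑ j, exp (t * y j) - exp (t ^ 2 / 2)) ^ 2 * exp (-β * t ^ 2) =
      √π * ((1 / n : ℝ) ^ 2 * ∑ j, ∑ k, exp ((y j + y k) ^ 2 / 4 / β) / √β
        - 2 * (1 / n : ℝ) * ∑ j, exp (y j ^ 2 / 4 / (β - 1 / 2)) / √(β - 1 / 2)
        + 1 / √(β - 1)) := by
  have hβ₀ : 0 < β := by linarith
  have hβ₁ : 0 < β - 1 / 2 := by linarith
  have hβ₂ : 0 < β - 1 := by linarith
  have expand : ∀ t : ℝ,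
      ((1 / n : ℝ) * ∑ j, exp (t * y j) - exp (t ^ 2 / 2)) ^ 2 * exp (-β * t ^ 2) =
        (1 / n : ℝ) ^ 2 * ∑ j, ∑ k, exp ((y j + y k) * t - β * t ^ 2)
        - 2 * (1 / n : ℝ) * ∑ j, exp (y j * t - (β - 1 / 2) * t ^ 2)
        + exp (0 * t - (β - 1) * t ^ 2) := by
    intro t
    have e1 : ∀ j k, exp ((y j + y k) * t - β * t ^ 2) =
        exp (t * y j) * exp (t * y k) * exp (-β * t ^ 2) := by
      intro j k
      rw [← Real.exp_add, ← Real.exp_add]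
      ring_nf
    have e2 : ∀ j, exp (y j * t - (β - 1 / 2) * t ^ 2) =
        exp (t * y j) * (exp (t ^ 2 / 2) * exp (-β * t ^ 2)) := by
      intro j
      rw [← Real.exp_add, ← Real.exp_add]
      ring_nf
    have e3 : exp (0 * t - (β - 1) * t ^ 2) = exp (t ^ 2 / 2) ^ 2 * exp (-β * t ^ 2) := by
      rw [sq (exp _), ← Real.exp_add, ← Real.exp_add]
      ring_nf
    simp_rw [e1, e2, e3, ← Finset.sum_mul, ← Finset.mul_sum, ← Finset.sum_mul]
    ring
  have i1 : ∀ j k, Integrable fun t : ℝ => exp ((y j + y k) * t - β * t ^ 2) :=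
    fun j k => integrable_exp_linear_sub_quadratic _ hβ₀
  have i2 : ∀ j, Integrable fun t : ℝ => exp (y j * t - (β - 1 / 2) * t ^ 2) :=
    fun j => integrable_exp_linear_sub_quadratic _ hβ₁
  have s1 : Integrable fun t : ℝ => ∑ j, ∑ k, exp ((y j + y k) * t - β * t ^ 2) :=
    integrable_finsetSum _ fun j _ => integrable_finsetSum _ fun k _ => i1 j k
  have s2 : Integrable fun t : ℝ => ∑ j, exp (y j * t - (β - 1 / 2) * t ^ 2) :=
    integrable_finsetSum _ fun j _ => i2 j
  have s12 : Integrable fun t : ℝ =>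
      (1 / n : ℝ) ^ 2 * ∑ j, ∑ k, exp ((y j + y k) * t - β * t ^ 2)
        - 2 * (1 / n : ℝ) * ∑ j, exp (y j * t - (β - 1 / 2) * t ^ 2) :=
    (s1.const_mul _).sub (s2.const_mul _)
  simp_rw [expand]
  rw [integral_add s12 (integrable_exp_linear_sub_quadratic 0 hβ₂),
    integral_sub (s1.const_mul _) (s2.const_mul _), integral_const_mul, integral_const_mul,
    integral_finsetSum _ fun j _ => integrable_finsetSum _ fun k _ => i1 j k,
    integral_finsetSum _ fun j _ => i2 j, integral_exp_linear_sub_quadratic 0 hβ₂]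
  simp_rw [fun j => integral_finsetSum Finset.univ fun k _ => i1 j k,
    integral_exp_linear_sub_quadratic _ hβ₀, integral_exp_linear_sub_quadratic _ hβ₁,
    ← Finset.mul_sum]
  simp only [ne_eq, OfNat.ofNat_ne_zero, not_false_eq_true, zero_pow, zero_div, exp_zero]
  ring

/-- The third-order Taylor coefficient of `exp`, as a limit at infinity. -/
lemma tendsto_cube_mul_exp_div_sub_taylor (a : ℝ) :
    Tendsto (fun x : ℝ => x ^ 3 * (exp (a / x) - 1 - a / x - (a / x) ^ 2 / 2)) atTop
      (nhds (a ^ 3 / 6)) := by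
  rw [tendsto_iff_norm_sub_tendsto_zero]
  have hlim : Tendsto (fun x : ℝ => |a| ^ 4 * x⁻¹) atTop (nhds 0) := by
    simpa using tendsto_inv_atTop_zero.const_mul (|a| ^ 4)
  refine squeeze_zero' (Eventually.of_forall fun _ => norm_nonneg _) ?_ hlim
  filter_upwards [eventually_ge_atTop |a|, eventually_gt_atTop 0] with x hx hx0
  have hax : |a / x| ≤ 1 := by
    rw [abs_div, abs_of_pos hx0]
    exact (div_le_one hx0).2 hx
  have hb := Real.exp_bound hax (n := 4) (by norm_num)
  have hsum : ∑ m ∈ Finset.range 4, (a / x) ^ m / (m.factorial : ℝ) =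
      1 + a / x + (a / x) ^ 2 / 2 + (a / x) ^ 3 / 6 := by
    simp [Finset.sum_range_succ, Nat.factorial]
  rw [hsum] at hb
  have hb' : |exp (a / x) - (1 + a / x + (a / x) ^ 2 / 2 + (a / x) ^ 3 / 6)| ≤ |a / x| ^ 4 := by
    refine hb.trans (mul_le_of_le_one_right (by positivity) ?_)
    norm_num [Nat.factorial]
  have heq : x ^ 3 * (exp (a / x) - 1 - a / x - (a / x) ^ 2 / 2) - a ^ 3 / 6 =
      x ^ 3 * (exp (a / x) - (1 + a / x + (a / x) ^ 2 / 2 + (a / x) ^ 3 / 6)) := by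
    field_simp
    ring
  rw [heq, Real.norm_eq_abs, abs_mul, abs_of_pos (by positivity : 0 < x ^ 3)]
  calc _ ≤ x ^ 3 * |a / x| ^ 4 := by gcongr
    _ = |a| ^ 4 * x⁻¹ := by
      rw [abs_div, abs_of_pos hx0]
      field_simp

lemma tendsto_div_sub_half_atTop :
    Tendsto (fun β : ℝ => β / (β - 1 / 2)) atTop (nhds 1) := by
  have h : Tendsto (fun β : ℝ => 1 + (1 / 2) * (β - 1 / 2)⁻¹) atTop (nhds (1 + (1 / 2) * 0)) :=
    ((tendsto_inv_atTop_zero.comp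
      (tendsto_atTop_add_const_right atTop (-(1 / 2) : ℝ) tendsto_id)).const_mul _).const_add _
  rw [mul_zero, add_zero] at h
  refine h.congr' ?_
  filter_upwards [eventually_gt_atTop 1] with β hβ
  have : β - 1 / 2 ≠ 0 := by linarith
  rw [eq_div_iff this, add_mul, mul_assoc, inv_mul_cancel₀ this]
  ring

lemma tendsto_sqrt_div_sqrt_sub_half_atTop :
    Tendsto (fun β : ℝ => √β / √(β - 1 / 2)) atTop (nhds 1) := by
  have h := tendsto_div_sub_half_atTop.sqrt
  rw [sqrt_one] at h
  refine h.congr' ?_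
  filter_upwards [eventually_gt_atTop 1] with β hβ
  exact sqrt_div (by linarith) _

lemma tendsto_mul_one_sub_sqrt_ratio_pow_five :
    Tendsto (fun β : ℝ => β * (1 - (√β / √(β - 1 / 2)) ^ 5)) atTop (nhds (-5 / 4)) := by
  have hr := tendsto_sqrt_div_sqrt_sub_half_atTop
  have h := (tendsto_div_sub_half_atTop.const_mul (-1 / 2)).mul
    ((((((hr.const_add 1).add (hr.pow 2)).add (hr.pow 3)).add (hr.pow 4))).div
      (hr.const_add 1) (by norm_num))
  rw [show (-1 / 2 * 1 * ((1 + 1 + 1 ^ 2 + 1 ^ 3 + 1 ^ 4) / (1 + 1)) : ℝ) = -5 / 4 by norm_num] at h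
  refine h.congr' ?_
  filter_upwards [eventually_gt_atTop 1] with β hβ
  have hγ : 0 < β - 1 / 2 := by linarith
  have hr2 : (√β / √(β - 1 / 2)) ^ 2 = β / (β - 1 / 2) := by
    rw [div_pow, sq_sqrt (by linarith), sq_sqrt hγ.le]
  have hr0 : 0 ≤ √β / √(β - 1 / 2) := by positivity
  simp only [Pi.div_apply]
  generalize √β / √(β - 1 / 2) = r at *
  have hβr : β / (β - 1 / 2) = 2 * β * (r ^ 2 - 1) := by
    have : β * 2 - 1 ≠ 0 := by linarith
    rw [hr2]
    field_simp
    ring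
  rw [hβr]
  field_simp
  ring

section PowerSums

variable {n : ℕ} {y : Fin n → ℝ}

lemma sum_sum_add_pow_two (h1 : ∑ i, y i = 0) (h2 : ∑ i, y i ^ 2 = n) :
    ∑ j, ∑ k, (y j + y k) ^ 2 = 2 * (n : ℝ) ^ 2 := by
  have e : ∀ j k, (y j + y k) ^ 2 = y j ^ 2 + 2 * y j * y k + y k ^ 2 := by intros; ring
  simp_rw [e, Finset.sum_add_distrib, ← Finset.mul_sum, h1, h2]
  simp [← Finset.mul_sum, h2]
  ring

lemma sum_sum_add_pow_four (h1 : ∑ i, y i = 0) (h2 : ∑ i, y i ^ 2 = n) :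
    ∑ j, ∑ k, (y j + y k) ^ 4 = 2 * n * ∑ i, y i ^ 4 + 6 * (n : ℝ) ^ 2 := by
  have e : ∀ j k, (y j + y k) ^ 4 =
      y j ^ 4 + 4 * y j ^ 3 * y k + 6 * y j ^ 2 * y k ^ 2 + 4 * y j * y k ^ 3 + y k ^ 4 := by
    intros; ring
  simp_rw [e, Finset.sum_add_distrib, ← Finset.mul_sum, ← Finset.sum_mul, ← Finset.mul_sum, h1, h2]
  simp [← Finset.mul_sum]
  ring

lemma sum_sum_add_pow_six (h1 : ∑ i, y i = 0) (h2 : ∑ i, y i ^ 2 = n) :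
    ∑ j, ∑ k, (y j + y k) ^ 6 =
      2 * n * ∑ i, y i ^ 6 + 30 * n * ∑ i, y i ^ 4 + 20 * (∑ i, y i ^ 3) ^ 2 := by
  have e : ∀ j k, (y j + y k) ^ 6 =
      y j ^ 6 + 6 * y j ^ 5 * y k + 15 * y j ^ 4 * y k ^ 2 + 20 * y j ^ 3 * y k ^ 3
        + 15 * y j ^ 2 * y k ^ 4 + 6 * y j * y k ^ 5 + y k ^ 6 := by
    intros; ring
  simp_rw [e, Finset.sum_add_distrib, ← Finset.mul_sum, ← Finset.sum_mul, ← Finset.mul_sum, h1, h2]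
  simp [← Finset.mul_sum]
  ring

end PowerSums

/-- As `β → ∞`, the suitably centered and rescaled statistic `T_{n,β}` approaches
squared sample skewness `b₁²`. -/
theorem Tnbeta_tendsto_skewness_sq (n : ℕ) (hn : 2 ≤ n) (y : Fin n → ℝ)
    (h1 : ∑ i, y i = 0) (h2 : ∑ i, (y i) ^ 2 = n) :
    Tendsto (fun β : ℝ =>
        (96 / 5) * β ^ (7 / 2 : ℝ) *
          (((n : ℝ) * ∫ t : ℝ,
              ((1 / n : ℝ) * ∑ j, Real.exp (t * y j) - Real.exp (t ^ 2 / 2)) ^ 2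
                * Real.exp (-β * t ^ 2)) / (n * Real.sqrt π)
            - (1 / Real.sqrt (β - 1) - 2 / Real.sqrt (β - 1 / 2)
                - 2 / ((4 * β - 2) * Real.sqrt (β - 1 / 2))
                + 1 / Real.sqrt β + 1 / (2 * β ^ (3 / 2 : ℝ))
                + 3 / (16 * β ^ (5 / 2 : ℝ)))))
      atTop (nhds (((1 / n : ℝ) * ∑ i, (y i) ^ 3) ^ 2)) := by
  have hn0 : (n : ℝ) ≠ 0 := by
    have : n ≠ 0 := by omega
    exact_mod_cast this
  let R : ℝ → ℝ → ℝ := fun a x => exp (a / x) - 1 - a / x - (a / x) ^ 2 / 2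
  have hshift : Tendsto (fun β : ℝ => β - 1 / 2) atTop atTop :=
    tendsto_atTop_add_const_right atTop (-(1 / 2) : ℝ) tendsto_id
  have hR1 : Tendsto (fun β : ℝ => ∑ j, ∑ k, β ^ 3 * R ((y j + y k) ^ 2 / 4) β) atTop
      (nhds (∑ j, ∑ k, ((y j + y k) ^ 2 / 4) ^ 3 / 6)) :=
    tendsto_finsetSum _ fun j _ => tendsto_finsetSum _ fun k _ =>
      tendsto_cube_mul_exp_div_sub_taylor _
  have hR2 : Tendsto (fun β : ℝ => ∑ j, (β - 1 / 2) ^ 3 * R (y j ^ 2 / 4) (β - 1 / 2)) atTop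
      (nhds (∑ j, (y j ^ 2 / 4) ^ 3 / 6)) :=
    tendsto_finsetSum _ fun j _ => (tendsto_cube_mul_exp_div_sub_taylor _).comp hshift
  have hlim := (((hR1.const_mul ((1 / n : ℝ) ^ 2)).sub
    (((tendsto_sqrt_div_sqrt_sub_half_atTop.pow 7).mul hR2).const_mul (2 * (1 / n : ℝ)))).add
    (tendsto_mul_one_sub_sqrt_ratio_pow_five.const_mul
      (1 / n * (∑ i, y i ^ 4) / 16))).const_mul (96 / 5)
  have hval : (96 / 5 : ℝ) * ((1 / n : ℝ) ^ 2 * ∑ j, ∑ k, ((y j + y k) ^ 2 / 4) ^ 3 / 6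
      - 2 * (1 / n : ℝ) * (1 ^ 7 * ∑ j, (y j ^ 2 / 4) ^ 3 / 6)
      + 1 / n * (∑ i, y i ^ 4) / 16 * (-5 / 4)) = ((1 / n : ℝ) * ∑ i, (y i) ^ 3) ^ 2 := by
    have e : ∀ a : ℝ, (a ^ 2 / 4) ^ 3 / 6 = a ^ 6 / 384 := by intro a; ring
    simp_rw [e, ← Finset.sum_div, sum_sum_add_pow_six h1 h2]
    field_simp
    ring
  rw [hval] at hlim
  refine hlim.congr' ?_
  filter_upwards [eventually_gt_atTop 1] with β hβ
  have hβ0 : 0 ≤ β := by linarith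
  have hγ0 : 0 < β - 1 / 2 := by linarith
  have hpow : ∀ k : ℕ, β ^ ((k : ℝ) / 2) = √β ^ k := fun k => by
    rw [sqrt_eq_rpow, ← rpow_natCast, ← rpow_mul hβ0]
    ring_nf
  have p7 : β ^ (7 / 2 : ℝ) = √β ^ 7 := by simpa using hpow 7
  have p5 : β ^ (5 / 2 : ℝ) = √β ^ 5 := by simpa using hpow 5
  have p3 : β ^ (3 / 2 : ℝ) = √β ^ 3 := by simpa using hpow 3
  have hsum1 : ∑ j, ∑ k, R ((y j + y k) ^ 2 / 4) β =
      ∑ j, ∑ k, exp ((y j + y k) ^ 2 / 4 / β) - (n : ℝ) ^ 2 - 2 * (n : ℝ) ^ 2 / (4 * β)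
        - (2 * n * ∑ i, y i ^ 4 + 6 * (n : ℝ) ^ 2) / (32 * β ^ 2) := by
    rw [← sum_sum_add_pow_four h1 h2, ← sum_sum_add_pow_two h1 h2]
    have e : ∀ a : ℝ, R (a ^ 2 / 4) β =
        exp (a ^ 2 / 4 / β) - 1 - a ^ 2 / (4 * β) - a ^ 4 / (32 * β ^ 2) := by
      intro a
      simp only [R]
      field_simp
      ring
    simp_rw [e, Finset.sum_sub_distrib, ← Finset.sum_div]
    simp [sq]
  have hsum2 : ∑ j, R (y j ^ 2 / 4) (β - 1 / 2) =
      ∑ j, exp (y j ^ 2 / 4 / (β - 1 / 2)) - n - n / (4 * (β - 1 / 2))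
        - (∑ i, y i ^ 4) / (32 * (β - 1 / 2) ^ 2) := by
    have e : ∀ a : ℝ, R (a ^ 2 / 4) (β - 1 / 2) =
        exp (a ^ 2 / 4 / (β - 1 / 2)) - 1 - a ^ 2 / (4 * (β - 1 / 2))
          - a ^ 4 / (32 * (β - 1 / 2) ^ 2) := by
      intro a
      simp only [R]
      generalize β - 1 / 2 = γ at *
      field_simp
      ring
    simp_rw [e, Finset.sum_sub_distrib, ← Finset.sum_div, h2]
    simp
  simp_rw [integral_sq_empirical_mgf_sub_gaussian y hβ, ← Finset.mul_sum, ← Finset.sum_div]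
  rw [hsum1, hsum2, p7, p5, p3]
  have hb0 : 0 < √β := sqrt_pos.2 (by linarith)
  have hg0 : 0 < √(β - 1 / 2) := sqrt_pos.2 hγ0
  have hc0 : 0 < √(β - 1) := sqrt_pos.2 (by linarith)
  have hπ : 0 < √π := sqrt_pos.2 pi_pos
  have hbb : β = √β ^ 2 := (sq_sqrt hβ0).symm
  have hgg : β - 1 / 2 = √(β - 1 / 2) ^ 2 := (sq_sqrt hγ0.le).symm
  have h4 : 4 * β - 2 = 4 * √(β - 1 / 2) ^ 2 := by rw [← hgg]; ring
  generalize ∑ j, ∑ k, exp ((y j + y k) ^ 2 / 4 / β) = E₁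
  generalize ∑ j, exp (y j ^ 2 / 4 / (β - 1 / 2)) = E₂
  generalize ∑ i, y i ^ 4 = M
  rw [h4]
  generalize √(β - 1) = c at *
  generalize √(β - 1 / 2) = g at *
  rw [hgg]
  generalize √β = b at *
  subst hbb
  field_simp
  ring
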